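/- There exists a constant C > 0 such that for all integers k > j ≥ 1, the uniform bridge B(k,·) in 𝓑_k^{≥−1} satisfies E[|B(k,j)|^3] ≤ C j^{3/2}; in particular E[|B(k,j)|^3] ≤ C (k−1)^{3/2} for all 1 ≤ j ≤ k. -/

import Mathlib

open MeasureTheory ProbabilityTheory Filter
open scoped ENNReal Classical

/-- The set `𝓑_k^{≥−1}` of discrete bridges: integer sequences `(b 1, …, b k)`
(0-indexed here as `b : Fin k → ℤ`) all of whose increments, starting from `b 0 = 0`,
are at least `-1`, and which end at `0`. -/
def IsBridge {k : ℕ} (b : Fin k → ℤ) : Prop :=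
  (∀ i : Fin k, -1 ≤ (Fin.cons 0 b : Fin (k + 1) → ℤ) i.succ
      - (Fin.cons 0 b : Fin (k + 1) → ℤ) i.castSucc) ∧
  (Fin.cons (0 : ℤ) b : Fin (k + 1) → ℤ) (Fin.last k) = 0

/-- Stars and bars: the number of `p`-tuples of natural numbers with sum `n`. -/
lemma card_antidiagonalTuple (p n : ℕ) :
    (Finset.Nat.antidiagonalTuple p n).card = p.multichoose n := by
  have e : {a // a ∈ Finset.Nat.antidiagonalTuple p n} ≃ Sym (Fin p) n :=
    (Equiv.subtypeEquivRight fun a => by simp [Finset.Nat.mem_antidiagonalTuple]).trans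
      (Sym.equivNatSumOfFintype (Fin p) n).symm
  rw [← Fintype.card_coe, Fintype.card_congr e, Sym.card_sym_eq_multichoose, Fintype.card_fin]

/-- Summing a function of the first `j` entries over all `(j + m)`-tuples with sum `n`. -/
lemma sum_antidiagonalTuple_add {R : Type*} [CommSemiring R] (j m n : ℕ) (g : ℕ → R) :
    ∑ a ∈ Finset.Nat.antidiagonalTuple (j + m) n, g (∑ i : Fin j, a (Fin.castAdd m i)) =
      ∑ p ∈ Finset.HasAntidiagonal.antidiagonal n,
        (j.multichoose p.1 * m.multichoose p.2 : ℕ) * g p.1 := by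
  rw [← Finset.sum_fiberwise_of_maps_to (t := Finset.HasAntidiagonal.antidiagonal n)
    (g := fun a => (∑ i : Fin j, a (Fin.castAdd m i), ∑ i : Fin m, a (Fin.natAdd j i)))]
  · refine Finset.sum_congr rfl fun p hp => ?_
    rw [Finset.sum_congr rfl (g := fun _ => g p.1), Finset.sum_const, nsmul_eq_mul,
      ← card_antidiagonalTuple j, ← card_antidiagonalTuple m, ← Finset.card_product]
    · congr 2
      refine Finset.card_equiv (Fin.appendEquiv j m).symm fun a => ?_
      obtain ⟨p1, p2⟩ := p
      rw [Finset.HasAntidiagonal.mem_antidiagonal] at hp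
      simp [Finset.Nat.mem_antidiagonalTuple, Fin.sum_univ_add, Fin.appendEquiv]
      omega
    · intro a ha
      simp only [Finset.mem_filter] at ha
      rw [← ha.2]
  · intro a ha
    rw [Finset.Nat.mem_antidiagonalTuple, Fin.sum_univ_add] at ha
    simpa using ha

/-- The Vandermonde identity for multiset coefficients. -/
lemma sum_antidiagonal_multichoose (j m n : ℕ) :
    ∑ p ∈ Finset.HasAntidiagonal.antidiagonal n, j.multichoose p.1 * m.multichoose p.2 =
      (j + m).multichoose n := by
  have := sum_antidiagonalTuple_add j m n (fun _ => (1 : ℕ))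
  simp only [Finset.sum_const, card_antidiagonalTuple, smul_eq_mul, mul_one, Nat.cast_id] at this
  exact this.symm

lemma choose_add_mul_multichoose (j r t : ℕ) (hj : 0 < j) :
    (t + r).choose r * j.multichoose (t + r) = j.multichoose r * (j + r).multichoose t := by
  obtain ⟨j, rfl⟩ := Nat.exists_eq_succ_of_ne_zero hj.ne'
  simp only [Nat.multichoose_eq]
  have h := Nat.choose_mul (n := j + t + r) (k := t + r) (s := t) (by omega)
  rw [Nat.choose_symm_add, show j + t + r - t = j + r by omega, show t + r - t = r by omega] at h
  rw [show j.succ + (t + r) - 1 = j + t + r by omega, show j.succ + r - 1 = j + r by omega,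
    show j.succ + r + t - 1 = j + t + r by omega]
  linarith

/-- The `r`-th binomial moment of the first block of a uniform composition. -/
lemma sum_choose_mul_multichoose (j m r q : ℕ) (hj : 0 < j) :
    ∑ p ∈ Finset.HasAntidiagonal.antidiagonal (r + q),
        p.1.choose r * (j.multichoose p.1 * m.multichoose p.2) =
      j.multichoose r * (j + r + m).multichoose q := by
  rw [Finset.Nat.sum_antidiagonal_eq_sum_range_succ
    (fun a b => a.choose r * (j.multichoose a * m.multichoose b)),
    Nat.succ_eq_add_one, add_assoc, Finset.sum_range_add, Finset.sum_eq_zero, zero_add,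
    ← sum_antidiagonal_multichoose, Finset.mul_sum, Finset.Nat.sum_antidiagonal_eq_sum_range_succ
    (fun a b => j.multichoose r * ((j + r).multichoose a * m.multichoose b))]
  · refine Finset.sum_congr rfl fun t _ => ?_
    rw [show r + q - (r + t) = q - t by omega, ← mul_assoc, ← mul_assoc, add_comm r t,
      choose_add_mul_multichoose j r t hj]
  · intro a ha
    rw [Nat.choose_eq_zero_of_lt (Finset.mem_range.1 ha), zero_mul]

lemma succ_mul_multichoose_succ (j r : ℕ) (hj : 0 < j) :
    (r + 1) * j.multichoose (r + 1) = (j + r) * j.multichoose r := by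
  obtain ⟨j, rfl⟩ := Nat.exists_eq_succ_of_ne_zero hj.ne'
  simp only [Nat.multichoose_eq]
  rw [show j.succ + (r + 1) - 1 = j + r + 1 by omega, show j.succ + r - 1 = j + r by omega]
  have := Nat.add_one_mul_choose_eq (j + r) r
  rw [Nat.succ_eq_add_one]
  linarith

/-- The `r`-th binomial moment, multiplied by the number of compositions of `j + m` into
`j + m` parts, of the sum of the first `j` parts. -/
noncomputable def binomialMoment (j m r : ℕ) : ℝ :=
  ∑ p ∈ Finset.HasAntidiagonal.antidiagonal (j + m),
    ((j.multichoose p.1 * m.multichoose p.2 : ℕ) : ℝ) * (p.1.choose r : ℝ)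

lemma binomialMoment_eq (j m r q : ℕ) (hj : 0 < j) (h : j + m = r + q) :
    binomialMoment j m r = j.multichoose r * (j + r + m).multichoose q := by
  rw [binomialMoment, h]
  have := congrArg (Nat.cast (R := ℝ)) (sum_choose_mul_multichoose j m r q hj)
  push_cast at this ⊢
  rw [← this]
  exact Finset.sum_congr rfl fun _ _ => by ring

lemma binomialMoment_eq_zero (j m r : ℕ) (h : j + m < r) : binomialMoment j m r = 0 := by
  refine Finset.sum_eq_zero fun p hp => ?_
  rw [Finset.HasAntidiagonal.mem_antidiagonal] at hp
  rw [Nat.choose_eq_zero_of_lt (by omega), Nat.cast_zero, mul_zero]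

lemma binomialMoment_zero_pos (j m : ℕ) (hj : 0 < j) : 0 < binomialMoment j m 0 := by
  rw [binomialMoment_eq j m 0 (j + m) hj (by omega), Nat.multichoose_zero_right,
    Nat.multichoose_eq]
  have := Nat.choose_pos (n := j + 0 + m + (j + m) - 1) (k := j + m) (by omega)
  positivity

lemma binomialMoment_succ (j m r : ℕ) (hj : 0 < j) :
    binomialMoment j m (r + 1) * ((r + 1) * (j + m + r)) =
      binomialMoment j m r * ((j + r) * (j + m - r)) := by
  obtain h | h | h := lt_trichotomy (j + m) r
  · rw [binomialMoment_eq_zero j m r h, binomialMoment_eq_zero j m _ (by omega)]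
    simp
  · rw [binomialMoment_eq_zero j m (r + 1) (by omega), ← h]
    simp
  · obtain ⟨q, hq⟩ : ∃ q, j + m = r + 1 + q := ⟨j + m - (r + 1), by omega⟩
    rw [binomialMoment_eq j m (r + 1) q hj hq, binomialMoment_eq j m r (q + 1) hj (by omega)]
    have h1 : ((r + 1 : ℝ)) * j.multichoose (r + 1) = (j + r) * j.multichoose r := mod_cast
      succ_mul_multichoose_succ j r hj
    have h2 : ((j + (r + 1) + m).multichoose q : ℝ) * (j + m + r) =
        (j + r + m).multichoose (q + 1) * (q + 1) := by
      simp only [Nat.multichoose_eq]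
      rw [show j + (r + 1) + m + q - 1 = j + r + m + q by omega,
        show j + r + m + (q + 1) - 1 = j + r + m + q by omega]
      have := Nat.choose_succ_right_eq (j + r + m + q) q
      rw [show j + r + m + q - q = j + m + r by omega] at this
      exact_mod_cast this.symm
    have h3 : (j + m - r : ℝ) = q + 1 := by
      have : (j + m : ℝ) = r + 1 + q := mod_cast hq
      linarith
    rw [h3]
    linear_combination ((j + (r + 1) + m).multichoose q : ℝ) * (j + m + r) * h1 +
      (j + r) * (j.multichoose r : ℝ) * h2

lemma choose_succ_mul (s r : ℕ) :
    (s.choose (r + 1) : ℝ) * (r + 1) = s.choose r * (s - r) := by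
  obtain h | h := le_total r s
  · have := Nat.choose_succ_right_eq s r
    rw [← Nat.cast_sub h]
    exact_mod_cast this
  · obtain rfl | h := h.eq_or_lt
    · simp
    · simp [Nat.choose_eq_zero_of_lt h, Nat.choose_eq_zero_of_lt (h.trans (Nat.lt_succ_self r))]

lemma sum_sub_sq_le (j m : ℕ) (hj : 0 < j) :
    ∑ p ∈ Finset.HasAntidiagonal.antidiagonal (j + m),
      ((j.multichoose p.1 * m.multichoose p.2 : ℕ) : ℝ) * ((p.1 : ℝ) - j) ^ 2 ≤
      2 * j * binomialMoment j m 0 := by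
  have h0 := binomialMoment_zero_pos j m hj
  have h1 := binomialMoment_succ j m 0 hj
  have h2 := binomialMoment_succ j m 1 hj
  have hE : ∑ p ∈ Finset.HasAntidiagonal.antidiagonal (j + m),
      ((j.multichoose p.1 * m.multichoose p.2 : ℕ) : ℝ) * ((p.1 : ℝ) - j) ^ 2 =
      2 * binomialMoment j m 2 + (1 - 2 * j) * binomialMoment j m 1 +
        j ^ 2 * binomialMoment j m 0 := by
    simp only [binomialMoment, Finset.mul_sum, ← Finset.sum_add_distrib]
    refine Finset.sum_congr rfl fun p _ => ?_
    have c2 := choose_succ_mul p.1 1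
    norm_num at c2 ⊢
    linear_combination (-(j.multichoose p.1 * m.multichoose p.2 : ℝ)) * c2
  rw [hE]
  obtain ⟨u, rfl⟩ := Nat.exists_eq_add_of_le' hj
  generalize binomialMoment (u + 1) m 0 = a at *
  generalize binomialMoment (u + 1) m (0 + 1) = b at *
  generalize binomialMoment (u + 1) m (1 + 1) = c at *
  push_cast at h1 h2 ⊢
  have hb : b = (u + 1) * a := by
    refine mul_right_cancel₀ (b := (u + 1 + m : ℝ)) (by positivity) ?_
    linear_combination h1
  rw [hb] at h2 ⊢
  have hc : c = a * ((u + 1) * (u + 2) * (u + m)) / (2 * (u + m + 2)) := by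
    rw [eq_div_iff (by positivity)]; linear_combination h2
  have hP : 0 ≤ a * (2 * (u + 1) * (u + 2)) / (u + m + 2) := by positivity
  refine le_of_sub_nonneg (hP.trans_eq ?_)
  rw [hc]
  field_simp
  ring

lemma sum_sub_pow_four_le (j m : ℕ) (hj : 0 < j) :
    ∑ p ∈ Finset.HasAntidiagonal.antidiagonal (j + m),
      ((j.multichoose p.1 * m.multichoose p.2 : ℕ) : ℝ) * ((p.1 : ℝ) - j) ^ 4 ≤
      40 * j ^ 2 * binomialMoment j m 0 := by
  have h0 := binomialMoment_zero_pos j m hj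
  have h1 := binomialMoment_succ j m 0 hj
  have h2 := binomialMoment_succ j m 1 hj
  have h3 := binomialMoment_succ j m 2 hj
  have h4 := binomialMoment_succ j m 3 hj
  have hE : ∑ p ∈ Finset.HasAntidiagonal.antidiagonal (j + m),
      ((j.multichoose p.1 * m.multichoose p.2 : ℕ) : ℝ) * ((p.1 : ℝ) - j) ^ 4 =
      24 * binomialMoment j m 4 + (36 - 24 * j) * binomialMoment j m 3 +
        (14 - 24 * j + 12 * j ^ 2) * binomialMoment j m 2 +
        (1 - 4 * j + 6 * j ^ 2 - 4 * j ^ 3) * binomialMoment j m 1 +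
        j ^ 4 * binomialMoment j m 0 := by
    simp only [binomialMoment, Finset.mul_sum, ← Finset.sum_add_distrib]
    refine Finset.sum_congr rfl fun p _ => ?_
    have c2 := choose_succ_mul p.1 1
    have c3 := choose_succ_mul p.1 2
    have c4 := choose_succ_mul p.1 3
    norm_num at c2 c3 c4 ⊢
    have e2 : (p.1.choose 2 : ℝ) = p.1 * (p.1 - 1) / 2 := by linarith
    have e3 : (p.1.choose 3 : ℝ) = p.1 * (p.1 - 1) * (p.1 - 2) / 6 := by
      rw [e2] at c3; linarith
    have e4 : (p.1.choose 4 : ℝ) = p.1 * (p.1 - 1) * (p.1 - 2) * (p.1 - 3) / 24 := by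
      rw [e3] at c4; linarith
    rw [e2, e3, e4]
    ring
  rw [hE]
  obtain ⟨u, rfl⟩ := Nat.exists_eq_add_of_le' hj
  generalize binomialMoment (u + 1) m 0 = a at *
  generalize binomialMoment (u + 1) m (0 + 1) = b at *
  generalize binomialMoment (u + 1) m (1 + 1) = c at *
  generalize binomialMoment (u + 1) m (2 + 1) = d at *
  generalize binomialMoment (u + 1) m (3 + 1) = e at *
  push_cast at h1 h2 h3 h4 ⊢
  have hb : b = (u + 1) * a := by
    refine mul_right_cancel₀ (b := (u + 1 + m : ℝ)) (by positivity) ?_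
    linear_combination h1
  rw [hb] at h2 ⊢
  have hc : c = a * ((u + 1) * (u + 2) * (u + m)) / (2 * (u + m + 2)) := by
    rw [eq_div_iff (by positivity)]; linear_combination h2
  rw [hc] at h3 ⊢
  have hd : d = a * ((u + 1) * (u + 2) * (u + 3) * (u + m) * (u + m - 1)) /
      (6 * (u + m + 2) * (u + m + 3)) := by
    rw [eq_div_iff (by positivity)]
    field_simp at h3
    linear_combination h3
  rw [hd] at h4 ⊢
  have he : e = a * ((u + 1) * (u + 2) * (u + 3) * (u + 4) *
      (u + m) * (u + m - 1) * (u + m - 2)) /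
      (24 * (u + m + 2) * (u + m + 3) * (u + m + 4)) := by
    rw [eq_div_iff (by positivity)]
    field_simp at h4
    linear_combination h4
  rw [he]
  refine le_of_sub_nonneg ?_
  field_simp
  ring_nf
  positivity

lemma sum_abs_sub_pow_three_le (j m : ℕ) (hj : 0 < j) :
    ∑ p ∈ Finset.HasAntidiagonal.antidiagonal (j + m),
      ((j.multichoose p.1 * m.multichoose p.2 : ℕ) : ℝ) * |(p.1 : ℝ) - j| ^ 3 ≤
      21 * (j : ℝ) ^ ((3 : ℝ) / 2) * binomialMoment j m 0 := by
  have ht : 0 < √(j : ℝ) := Real.sqrt_pos.2 (mod_cast hj)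
  have htt : √(j : ℝ) ^ 2 = j := Real.sq_sqrt j.cast_nonneg
  have h2 := sum_sub_sq_le j m hj
  have h4 := sum_sub_pow_four_le j m hj
  have hpow : (j : ℝ) ^ ((3 : ℝ) / 2) = √j ^ 3 := by
    rw [Real.sqrt_eq_rpow, ← Real.rpow_natCast, ← Real.rpow_mul j.cast_nonneg]
    norm_num
  rw [hpow]
  generalize √(j : ℝ) = t at *
  refine le_of_mul_le_mul_left ?_ (by positivity : 0 < 2 * t)
  calc _ ≤ ∑ p ∈ Finset.HasAntidiagonal.antidiagonal (j + m),
        (((j.multichoose p.1 * m.multichoose p.2 : ℕ) : ℝ) * ((p.1 : ℝ) - j) ^ 4 +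
          t ^ 2 * (((j.multichoose p.1 * m.multichoose p.2 : ℕ) : ℝ) * ((p.1 : ℝ) - j) ^ 2)) := by
        rw [Finset.mul_sum]
        refine Finset.sum_le_sum fun p _ => ?_
        rw [← Even.pow_abs (by decide : Even 4), ← sq_abs (_ - _)]
        generalize |(p.1 : ℝ) - j| = x at *
        have : 0 ≤ ((j.multichoose p.1 * m.multichoose p.2 : ℕ) : ℝ) * (x ^ 2 * (x - t) ^ 2) := by
          positivity
        linear_combination this
    _ ≤ 40 * j ^ 2 * binomialMoment j m 0 + t ^ 2 * (2 * j * binomialMoment j m 0) := by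
        rw [Finset.sum_add_distrib, ← Finset.mul_sum]
        gcongr
    _ = _ := by rw [← htt]; ring

/-- The walk with increments `a i - 1`. -/
def compositionBridge {k : ℕ} (a : Fin k → ℕ) : Fin k → ℤ :=
  Fin.tail (Fin.partialSum fun i => (a i : ℤ) - 1)

lemma cons_compositionBridge {k : ℕ} (a : Fin k → ℕ) :
    (Fin.cons 0 (compositionBridge a) : Fin (k + 1) → ℤ) =
      Fin.partialSum fun i => (a i : ℤ) - 1 := by
  rw [compositionBridge, ← Fin.partialSum_zero (fun i => (a i : ℤ) - 1), Fin.cons_self_tail]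

lemma partialSum_apply_eq_sum {M : Type*} [AddCommMonoid M] {k : ℕ} (f : Fin k → M)
    (j : ℕ) (h : j < k + 1) :
    Fin.partialSum f ⟨j, h⟩ = ∑ i : Fin j, f (Fin.castLE (by omega) i) := by
  induction j with
  | zero => simp
  | succ j ih =>
    rw [Fin.sum_univ_castSucc, show (⟨j + 1, h⟩ : Fin (k + 1)) = Fin.succ ⟨j, by omega⟩ from rfl,
      Fin.partialSum_succ, Fin.castSucc_mk, ih (by omega)]
    rfl

lemma compositionBridge_injective {k : ℕ} :
    Function.Injective (compositionBridge : (Fin k → ℕ) → Fin k → ℤ) := by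
  intro a a' h
  have h' : (Fin.partialSum fun i => (a i : ℤ) - 1) = Fin.partialSum fun i => (a' i : ℤ) - 1 := by
    rw [← cons_compositionBridge, ← cons_compositionBridge, h]
  funext i
  have h1 := congrFun h' i.succ
  rw [Fin.partialSum_succ, Fin.partialSum_succ, h'] at h1
  simpa using h1

lemma isBridge_iff {k : ℕ} (b : Fin k → ℤ) :
    IsBridge b ↔ b ∈ (Finset.Nat.antidiagonalTuple k k).image compositionBridge := by
  have hlast (a : Fin k → ℕ) :
      Fin.partialSum (fun i => (a i : ℤ) - 1) (Fin.last k) = ((∑ i, a i : ℕ) : ℤ) - k := by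
    rw [Fin.last, partialSum_apply_eq_sum]
    simp
  rw [Finset.mem_image]
  constructor
  · rintro ⟨h1, h2⟩
    set c : Fin (k + 1) → ℤ := Fin.cons 0 b with hc
    let a : Fin k → ℕ := fun i => (c i.succ - c i.castSucc + 1).toNat
    have ha (i : Fin k) : (a i : ℤ) - 1 = c i.succ - c i.castSucc := by
      have := h1 i
      simp only [a]
      omega
    have hs : (Fin.partialSum fun i => (a i : ℤ) - 1) = c := by
      funext t
      induction t using Fin.induction with
      | zero => simp [hc]
      | succ i ih => rw [Fin.partialSum_succ, ih, ha]; ring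
    refine ⟨a, ?_, ?_⟩
    · rw [Finset.Nat.mem_antidiagonalTuple]
      have := hlast a
      rw [hs, h2] at this
      omega
    · rw [compositionBridge, hs, hc, Fin.tail_cons]
  · rintro ⟨a, ha, rfl⟩
    rw [Finset.Nat.mem_antidiagonalTuple] at ha
    rw [IsBridge, cons_compositionBridge, hlast, ha]
    refine ⟨fun i => ?_, by simp⟩
    rw [Fin.partialSum_succ]
    omega

lemma card_isBridge (k : ℕ) :
    Nat.card {b : Fin k → ℤ // IsBridge b} = (Finset.Nat.antidiagonalTuple k k).card := by
  rw [← Finset.card_image_of_injective _ compositionBridge_injective,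
    Nat.card_congr (Equiv.subtypeEquivRight isBridge_iff), Nat.card_eq_fintype_card,
    Fintype.card_coe]

lemma sum_abs_compositionBridge_pow_three_le (k j : ℕ) (i : Fin k) (hi : (i : ℕ) + 1 = j) (hjk : j < k) :
    ∑ a ∈ Finset.Nat.antidiagonalTuple k k,
        (|compositionBridge a i| : ℝ) ^ 3 ≤
      21 * (j : ℝ) ^ ((3 : ℝ) / 2) * (Finset.Nat.antidiagonalTuple k k).card := by
  obtain ⟨m, rfl⟩ := Nat.exists_eq_add_of_le hjk.le
  have happ (a : Fin (j + m) → ℕ) : (compositionBridge a i : ℝ) =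
      ((∑ i : Fin j, a (Fin.castAdd m i) : ℕ) : ℝ) - j := by
    have : compositionBridge a i =
        Fin.partialSum (fun i => (a i : ℤ) - 1) ⟨j, by omega⟩ := by
      rw [compositionBridge, Fin.tail]
      congr 1
      ext
      simp [hi]
    rw [this, partialSum_apply_eq_sum]
    simp [Fin.castAdd]
  simp only [happ]
  rw [sum_antidiagonalTuple_add j m (j + m) (fun s => |(s : ℝ) - j| ^ 3)]
  refine (sum_abs_sub_pow_three_le j m (by omega)).trans_eq ?_
  rw [binomialMoment_eq j m 0 (j + m) (by omega) (by omega), card_antidiagonalTuple]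
  simp

/-- The law of the unconscious statistician as an upper bound:
no measurability of `B` is needed, thanks to measurable hulls. -/
lemma lintegral_comp_le_tsum {Ω α : Type*} [MeasurableSpace Ω] [Countable α] (μ : Measure Ω)
    (B : Ω → α) (f : α → ℝ≥0∞) :
    ∫⁻ ω, f (B ω) ∂μ ≤ ∑' b, f b * μ {ω | B ω = b} := by
  calc ∫⁻ ω, f (B ω) ∂μ
      ≤ ∫⁻ ω, ∑' b, (toMeasurable μ {ω | B ω = b}).indicator (fun _ => f b) ω ∂μ := by
        refine lintegral_mono fun ω => ?_
        refine le_trans ?_ (ENNReal.le_tsum (B ω))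
        rw [Set.indicator_of_mem (subset_toMeasurable μ {ω' | B ω' = B ω} rfl)]
    _ = ∑' b, f b * μ {ω | B ω = b} := by
        rw [lintegral_tsum fun b =>
          (measurable_const.indicator (measurableSet_toMeasurable _ _)).aemeasurable]
        simp_rw [lintegral_indicator_const (measurableSet_toMeasurable _ _), measure_toMeasurable]

lemma integral_abs_bridge_pow_three_le (k j : ℕ) (i : Fin k) (hi : (i : ℕ) + 1 = j) (hjk : j < k)
    {Ω : Type*} [MeasurableSpace Ω] (μ : Measure Ω) (B : Ω → Fin k → ℤ)
    (hB : ∀ b : Fin k → ℤ, μ {ω | B ω = b} =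
      if IsBridge b then (Nat.card {b' : Fin k → ℤ // IsBridge b'} : ℝ≥0∞)⁻¹ else 0) :
    ∫ ω, (|B ω i| : ℝ) ^ 3 ∂μ ≤ 21 * (j : ℝ) ^ ((3 : ℝ) / 2) := by
  by_cases hm : AEStronglyMeasurable (fun ω => (|B ω i| : ℝ) ^ 3) μ
  swap
  · rw [integral_undef fun h => hm h.1]
    positivity
  rw [integral_eq_lintegral_of_nonneg_ae (Eventually.of_forall fun ω => by positivity) hm]
  refine ENNReal.toReal_le_of_le_ofReal (by positivity) ?_
  refine (lintegral_comp_le_tsum μ B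
    (fun b => ENNReal.ofReal ((|b i| : ℝ) ^ 3))).trans ?_
  have hN : 0 < (Finset.Nat.antidiagonalTuple k k).card := by
    rw [card_antidiagonalTuple, Nat.multichoose_eq]
    exact Nat.choose_pos (by omega)
  simp_rw [hB, isBridge_iff, mul_ite, mul_zero]
  rw [tsum_eq_sum (s := (Finset.Nat.antidiagonalTuple k k).image compositionBridge)
    (fun b hb => if_neg hb), Finset.sum_congr rfl fun b hb => if_pos hb, ← Finset.sum_mul,
    Finset.sum_image compositionBridge_injective.injOn,
    ← ENNReal.ofReal_sum_of_nonneg fun a _ => by positivity]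
  simp_rw [← isBridge_iff]
  rw [card_isBridge, ← div_eq_mul_inv]
  refine ENNReal.div_le_of_le_mul ?_
  rw [← ENNReal.ofReal_natCast, ← ENNReal.ofReal_mul (by positivity)]
  exact ENNReal.ofReal_le_ofReal (sum_abs_compositionBridge_pow_three_le k j i hi hjk)

/-- There is a constant `C > 0` such that for all integers `k > j ≥ 1`, a uniform
bridge `B(k,·)` of `𝓑_k^{≥−1}` satisfies `E[|B(k,j)|³] ≤ C j^{3/2}`; in particular
`E[|B(k,j)|³] ≤ C (k−1)^{3/2}` for all `1 ≤ j ≤ k`. -/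
theorem stmt6 :
    ∃ C : ℝ, 0 < C ∧
      (∀ (k j : ℕ) (hj : 1 ≤ j) (hjk : j < k)
        (Ω : Type) (_ : MeasurableSpace Ω) (μ : Measure Ω) (_ : IsProbabilityMeasure μ)
        (B : Ω → Fin k → ℤ),
        (∀ b : Fin k → ℤ, μ {ω | B ω = b} =
          if IsBridge b then (Nat.card {b' : Fin k → ℤ // IsBridge b'} : ℝ≥0∞)⁻¹ else 0) →
        ∫ ω, (|B ω ⟨j - 1, by omega⟩| : ℝ) ^ 3 ∂μ ≤ C * (j : ℝ) ^ ((3 : ℝ) / 2)) ∧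
      (∀ (k j : ℕ) (hj : 1 ≤ j) (hjk : j ≤ k)
        (Ω : Type) (_ : MeasurableSpace Ω) (μ : Measure Ω) (_ : IsProbabilityMeasure μ)
        (B : Ω → Fin k → ℤ),
        (∀ b : Fin k → ℤ, μ {ω | B ω = b} =
          if IsBridge b then (Nat.card {b' : Fin k → ℤ // IsBridge b'} : ℝ≥0∞)⁻¹ else 0) →
        ∫ ω, (|B ω ⟨j - 1, by omega⟩| : ℝ) ^ 3 ∂μ ≤ C * ((k : ℝ) - 1) ^ ((3 : ℝ) / 2)) := by
  refine ⟨21, by norm_num, fun k j hj hjk Ω _ μ _ B hB =>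
    integral_abs_bridge_pow_three_le k j _ (Nat.sub_add_cancel hj) hjk μ B hB, fun k j hj hjk Ω _ μ _ B hB => ?_⟩
  obtain hjk | rfl := hjk.lt_or_eq
  · refine (integral_abs_bridge_pow_three_le k j _ (Nat.sub_add_cancel hj) hjk μ B hB).trans ?_
    have : (j : ℝ) + 1 ≤ k := mod_cast hjk
    gcongr
    linarith
  · have hae : ∀ᵐ ω ∂μ, (|B ω ⟨j - 1, by omega⟩| : ℝ) ^ 3 = 0 := by
      have h : ∀ᵐ ω ∂μ, ∀ b : Fin j → ℤ, ¬ IsBridge b → B ω ≠ b := by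
        refine ae_all_iff.2 fun b => ?_
        by_cases hb : IsBridge b
        · simp [hb]
        · have := hB b
          rw [if_neg hb] at this
          filter_upwards [measure_eq_zero_iff_ae_notMem.1 this] with ω hω _ h
          exact hω h
      filter_upwards [h] with ω hω
      obtain ⟨i, rfl⟩ := Nat.exists_eq_add_of_le' hj
      have hbr : IsBridge (B ω) := by_contra fun hb => hω _ hb rfl
      have h0 : B ω (Fin.last i) = 0 := by
        have := hbr.2
        rwa [← Fin.succ_last, Fin.cons_succ] at this
      have h1 : B ω ⟨i + 1 - 1, by omega⟩ = 0 := h0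
      rw [h1]
      simp
    rw [integral_congr_ae hae, integral_zero]
    have : (1 : ℝ) ≤ j := mod_cast hj
    have : (0 : ℝ) ≤ j - 1 := by linarith
    positivity
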